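/- arXiv:1509.08648 — 3 statements merged into one kernel-verified Lean document; each statement's English description precedes it below -/
import Mathlib

section
/- Let X be a real Banach space, let x̄ ∈ X, let r > 0, and let f : X → X be Fréchet differentiable on the closed ball B_r(x̄) of radius r centered at x̄. Let A and A† be bounded linear operators on X with A injective, and let Y, Z₀, Z₁, Z₂ ≥ 0 be constants satisfying: ‖A f(x̄)‖ ≤ Y; ‖I − A A†‖ ≤ Z₀ (operator norm); and for every b ∈ B_r(x̄) and every u ∈ X with ‖u‖ ≤ 1, ‖A (Df(b) − A†) u‖ ≤ Z₁ + Z₂ r. If the radii polynomial satisfies p(r) = Y + (Z₀ + Z₁ − 1) r + Z₂ r² < 0, then there exists a unique x̃ ∈ B_r(x̄) such that f(x̃) = 0. -/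
/-- A differentiable Newton-like map `x ↦ x - A (f x)` on a closed ball, with `A` injective,
derivative bounded by `K < 1`, and a small enough residual at the centre, has a unique fixed point,
which is the unique zero of `f` in the ball. -/
theorem existsUnique_zero_of_norm_hasFDerivWithinAt_le
    {X : Type*} [NormedAddCommGroup X] [NormedSpace ℝ X] [CompleteSpace X]
    {c : X} {r : ℝ} (hr : 0 ≤ r) {f : X → X} {A : X →L[ℝ] X} (hA : Function.Injective A)
    {T' : X → X →L[ℝ] X} {K Y : ℝ}
    (hderiv : ∀ b ∈ Metric.closedBall c r,
      HasFDerivWithinAt (fun x => x - A (f x)) (T' b) (Metric.closedBall c r) b)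
    (hbound : ∀ b ∈ Metric.closedBall c r, ‖T' b‖ ≤ K) (hK0 : 0 ≤ K) (hK1 : K < 1)
    (hY : ‖A (f c)‖ ≤ Y) (hr' : Y + K * r ≤ r) :
    ∃! x : X, x ∈ Metric.closedBall c r ∧ f x = 0 := by
  set T : X → X := fun x => x - A (f x) with hT
  have hfix : ∀ x, T x = x ↔ f x = 0 := fun x => by
    rw [hT, sub_eq_self, map_eq_zero_iff A hA]
  have hlip : ∀ x ∈ Metric.closedBall c r, ∀ y ∈ Metric.closedBall c r,
      ‖T y - T x‖ ≤ K * ‖y - x‖ := fun x hx y hy =>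
    (convex_closedBall c r).norm_image_sub_le_of_norm_hasFDerivWithin_le hderiv hbound hx hy
  have hc : c ∈ Metric.closedBall c r := Metric.mem_closedBall_self hr
  have hmaps : Set.MapsTo T (Metric.closedBall c r) (Metric.closedBall c r) := by
    intro x hx
    have hx' : ‖x - c‖ ≤ r := mem_closedBall_iff_norm.1 hx
    rw [mem_closedBall_iff_norm]
    calc ‖T x - c‖ = ‖(T x - T c) - A (f c)‖ := by simp only [hT]; congr 1; abel
      _ ≤ ‖T x - T c‖ + ‖A (f c)‖ := norm_sub_le _ _
      _ ≤ K * ‖x - c‖ + Y := add_le_add (hlip c hc x hx) hY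
      _ ≤ K * r + Y := by gcongr
      _ ≤ r := by linarith
  have hcontr : ContractingWith ⟨K, hK0⟩ (hmaps.restrict T _ _) := by
    refine ⟨hK1, LipschitzWith.of_dist_le_mul fun x y => ?_⟩
    rw [Subtype.dist_eq, Subtype.dist_eq, dist_eq_norm, dist_eq_norm]
    exact hlip y y.2 x x.2
  obtain ⟨x, hx, hTx, -⟩ := hcontr.exists_fixedPoint' Metric.isClosed_closedBall.isComplete
    hmaps hc (edist_ne_top _ _)
  refine ⟨x, ⟨hx, (hfix x).1 hTx⟩, fun y ⟨hy, hfy⟩ => ?_⟩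
  exact congrArg Subtype.val (hcontr.fixedPoint_unique' (x := ⟨y, hy⟩) (y := ⟨x, hx⟩)
    (Subtype.ext ((hfix y).2 hfy)) (Subtype.ext hTx))


/-- The radii polynomial (Newton–Kantorovich type) lemma: if the radii polynomial
`p(r) = Y + (Z₀ + Z₁ − 1) r + Z₂ r²` is negative at `r`, then there is a unique zero
of `f` in the closed ball of radius `r` around `x̄`. -/
theorem radii_polynomial_approach
    {X : Type*} [NormedAddCommGroup X] [NormedSpace ℝ X] [CompleteSpace X]
    (xbar : X) (r : ℝ) (hr : 0 < r)
    (f : X → X) (Df : X → X →L[ℝ] X)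
    (hf : ∀ b ∈ Metric.closedBall xbar r,
      HasFDerivWithinAt f (Df b) (Metric.closedBall xbar r) b)
    (A Adag : X →L[ℝ] X) (hA : Function.Injective A)
    (Y Z₀ Z₁ Z₂ : ℝ) (hY : 0 ≤ Y) (hZ₀ : 0 ≤ Z₀) (hZ₁ : 0 ≤ Z₁) (hZ₂ : 0 ≤ Z₂)
    (hYb : ‖A (f xbar)‖ ≤ Y)
    (hZ₀b : ‖ContinuousLinearMap.id ℝ X - A.comp Adag‖ ≤ Z₀)
    (hZ₁b : ∀ b ∈ Metric.closedBall xbar r, ∀ u : X, ‖u‖ ≤ 1 →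
      ‖A ((Df b - Adag) u)‖ ≤ Z₁ + Z₂ * r)
    (hp : Y + (Z₀ + Z₁ - 1) * r + Z₂ * r ^ 2 < 0) :
    ∃! x : X, x ∈ Metric.closedBall xbar r ∧ f x = 0 := by
  have hKr : Y + (Z₀ + (Z₁ + Z₂ * r)) * r < r := by nlinarith
  have hK0 : 0 ≤ Z₀ + (Z₁ + Z₂ * r) := by positivity
  have hK1 : Z₀ + (Z₁ + Z₂ * r) < 1 := by
    by_contra! h
    nlinarith
  have hderiv : ∀ b ∈ Metric.closedBall xbar r,
      HasFDerivWithinAt (fun x => x - A (f x)) (ContinuousLinearMap.id ℝ X - A.comp (Df b))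
        (Metric.closedBall xbar r) b := fun b hb =>
    (hasFDerivWithinAt_id b _).sub (A.hasFDerivAt.comp_hasFDerivWithinAt b (hf b hb))
  have hbound : ∀ b ∈ Metric.closedBall xbar r,
      ‖ContinuousLinearMap.id ℝ X - A.comp (Df b)‖ ≤ Z₀ + (Z₁ + Z₂ * r) := by
    intro b hb
    have hsplit : ContinuousLinearMap.id ℝ X - A.comp (Df b) =
        (ContinuousLinearMap.id ℝ X - A.comp Adag) - A.comp (Df b - Adag) := by
      rw [ContinuousLinearMap.comp_sub]
      abel
    rw [hsplit]
    refine (norm_sub_le _ _).trans (add_le_add hZ₀b ?_)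
    exact ContinuousLinearMap.opNorm_le_of_unit_norm (by positivity)
      fun u hu => hZ₁b b hb u hu.le
  exact existsUnique_zero_of_norm_hasFDerivWithinAt_le hr.le hA hderiv hbound hK0 hK1
    hYb hKr.le
end

section
/- Let ν > 1 and let Z²₊ = {(k₁,k₂) ∈ ℤ² : k₁ ≥ 0, k₂ > 0}. For x, y : Z²₊ → ℝ with finite weighted norms ‖x‖_ν and ‖y‖_ν, the convolution (sym(x) * sym(y))_k = ∑_{j ∈ ℤ²} sym(x)_j sym(y)_{k−j} is well-defined and satisfies ∑_{k ∈ Z²₊} |(sym(x) * sym(y))_k| ν^{|k|} ≤ 16 ‖x‖_ν ‖y‖_ν. -/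
/-- The symmetrization of a sequence indexed by `Z²₊ = {k : k₁ ≥ 0, k₂ > 0}`. -/
def sym (x : ℤ × ℤ → ℝ) : ℤ × ℤ → ℝ :=
  fun k => if k.2 = 0 then 0 else x (|k.1|, |k.2|)

/-- The geometric weight `ν^{|k|}`, `|k| = |k₁| + |k₂|`. -/
noncomputable def wt (ν : ℝ) (k : ℤ × ℤ) : ℝ :=
  ν ^ (k.1.natAbs + k.2.natAbs)

/-- Discrete convolution of bi-infinite `ℤ²`-sequences. -/
noncomputable def conv (a b : ℤ × ℤ → ℝ) : ℤ × ℤ → ℝ :=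
  fun k => ∑' j : ℤ × ℤ, a j * b (k - j)

lemma one_le_wt {ν : ℝ} (hν : 1 < ν) (k : ℤ × ℤ) : 1 ≤ wt ν k :=
  one_le_pow₀ hν.le

/-- The weight is submultiplicative. -/
lemma wt_le_mul_wt_sub {ν : ℝ} (hν : 1 < ν) (j k : ℤ × ℤ) :
    wt ν k ≤ wt ν j * wt ν (k - j) := by
  unfold wt
  rw [← pow_add]
  refine pow_le_pow_right₀ hν.le ?_
  simp only [Prod.fst_sub, Prod.snd_sub]
  omega

/-- The symmetrization of `x` has weighted `ℓ¹` norm over `ℤ²` at most four times that of `x`. -/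
lemma summable_sym_and_tsum_le {ν : ℝ} (hν : 1 < ν) (x : ℤ × ℤ → ℝ)
    (hx : Summable (fun k : {k : ℤ × ℤ // 0 ≤ k.1 ∧ 0 < k.2} => |x k.1| * wt ν k.1)) :
    Summable (fun k => |sym x k| * wt ν k) ∧
      ∑' k, |sym x k| * wt ν k ≤
        4 * ∑' k : {k : ℤ × ℤ // 0 ≤ k.1 ∧ 0 < k.2}, |x k.1| * wt ν k.1 := by
  have wt_nonneg (k : ℤ × ℤ) : 0 ≤ wt ν k := zero_le_one.trans (one_le_wt hν k)
  let fold : {k : ℤ × ℤ // k.2 ≠ 0} → {k : ℤ × ℤ // 0 ≤ k.1 ∧ 0 < k.2} × (Bool × Bool) :=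
    fun k => (⟨(|k.1.1|, |k.1.2|), abs_nonneg _, abs_pos.2 k.2⟩,
      (decide (k.1.1 < 0), decide (k.1.2 < 0)))
  have fold_injective : Function.Injective fold := by
    rintro ⟨⟨a, b⟩, h⟩ ⟨⟨c, d⟩, h'⟩ hcd
    simp only [fold, Prod.mk.injEq, Subtype.mk.injEq, decide_eq_decide] at hcd
    obtain ⟨⟨h1, h2⟩, h3, h4⟩ := hcd
    simp only [Subtype.mk.injEq, Prod.mk.injEq]
    constructor <;> grind
  let g : {k : ℤ × ℤ // 0 ≤ k.1 ∧ 0 < k.2} × (Bool × Bool) → ℝ :=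
    fun p => |x p.1.1| * wt ν p.1.1 * 1
  have one_summable : Summable (fun _ : Bool × Bool => (1 : ℝ)) :=
    (hasSum_fintype _).summable
  have g_nonneg (p) : 0 ≤ g p := by
    have := wt_nonneg p.1.1
    positivity
  have g_summable : Summable g :=
    hx.mul_of_nonneg one_summable (fun k => mul_nonneg (abs_nonneg _) (wt_nonneg _))
      (fun _ => zero_le_one)
  have g_tsum : ∑' p, g p =
      4 * ∑' k : {k : ℤ × ℤ // 0 ≤ k.1 ∧ 0 < k.2}, |x k.1| * wt ν k.1 := by
    rw [← hx.tsum_mul_tsum one_summable g_summable,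
      tsum_fintype (fun _ : Bool × Bool => (1 : ℝ))]
    norm_num [mul_comm]
  have sym_eq : (fun k : {k : ℤ × ℤ // k.2 ≠ 0} => |sym x k.1| * wt ν k.1) = g ∘ fold := by
    funext k
    simp [g, fold, sym, wt, k.2, Int.natAbs_abs]
  have support_subset :
      Function.support (fun k => |sym x k| * wt ν k) ⊆ {k : ℤ × ℤ | k.2 ≠ 0} := by
    intro k hk h
    exact hk (by simp [sym, h])
  constructor
  · rw [← Set.indicator_eq_self.2 support_subset, ← summable_subtype_iff_indicator]
    have h := g_summable.comp_injective fold_injective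
    rw [← sym_eq] at h
    exact h
  · rw [← tsum_subtype_eq_of_support_subset support_subset, ← g_tsum]
    calc _ = ∑' k, (g ∘ fold) k := by rw [← sym_eq]; rfl
      _ ≤ _ := tsum_comp_le_tsum_of_inj g_summable g_nonneg fold_injective

/-- `‖sym(x) * sym(y)‖_ν ≤ 16 ‖x‖_ν ‖y‖_ν`: the convolution of two symmetrized
sequences is well-defined and its weighted ℓ¹ norm over `Z²₊` is bounded by
`16` times the product of the weighted ℓ¹ norms of `x` and `y`. -/
theorem sym_conv_norm_le (ν : ℝ) (hν : 1 < ν) (x y : ℤ × ℤ → ℝ)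
    (hx : Summable (fun k : {k : ℤ × ℤ // 0 ≤ k.1 ∧ 0 < k.2} => |x k.1| * wt ν k.1))
    (hy : Summable (fun k : {k : ℤ × ℤ // 0 ≤ k.1 ∧ 0 < k.2} => |y k.1| * wt ν k.1)) :
    (∀ k : ℤ × ℤ, Summable (fun j : ℤ × ℤ => sym x j * sym y (k - j))) ∧
    Summable (fun k : {k : ℤ × ℤ // 0 ≤ k.1 ∧ 0 < k.2} =>
      |conv (sym x) (sym y) k.1| * wt ν k.1) ∧
    (∑' k : {k : ℤ × ℤ // 0 ≤ k.1 ∧ 0 < k.2}, |conv (sym x) (sym y) k.1| * wt ν k.1) ≤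
      16 * (∑' k : {k : ℤ × ℤ // 0 ≤ k.1 ∧ 0 < k.2}, |x k.1| * wt ν k.1) *
        (∑' k : {k : ℤ × ℤ // 0 ≤ k.1 ∧ 0 < k.2}, |y k.1| * wt ν k.1) := by
  obtain ⟨hX, hXle⟩ := summable_sym_and_tsum_le hν x hx
  obtain ⟨hY, hYle⟩ := summable_sym_and_tsum_le hν y hy
  have wt_nonneg (k : ℤ × ℤ) : 0 ≤ wt ν k := zero_le_one.trans (one_le_wt hν k)
  set A : ℤ × ℤ → ℝ := fun k => |sym x k| * wt ν k
  set B : ℤ × ℤ → ℝ := fun k => |sym y k| * wt ν k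
  have hA (k) : 0 ≤ A k := mul_nonneg (abs_nonneg _) (wt_nonneg k)
  have hB (k) : 0 ≤ B k := mul_nonneg (abs_nonneg _) (wt_nonneg k)
  let e : (ℤ × ℤ) × (ℤ × ℤ) ≃ (ℤ × ℤ) × (ℤ × ℤ) :=
    { toFun := fun p => (p.2, p.1 - p.2)
      invFun := fun p => (p.1 + p.2, p.1)
      left_inv := fun p => by simp
      right_inv := fun p => by simp }
  have hAB : Summable (fun p : (ℤ × ℤ) × (ℤ × ℤ) => A p.1 * B p.2) :=
    hX.mul_of_nonneg hY hA hB
  have hC : Summable (fun p : (ℤ × ℤ) × (ℤ × ℤ) => A p.2 * B (p.1 - p.2)) :=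
    e.summable_iff.2 hAB
  have hC_tsum : ∑' k, ∑' j, A j * B (k - j) = (∑' k, A k) * ∑' k, B k := by
    rw [hX.tsum_mul_tsum hY hAB, ← e.tsum_eq]
    exact hC.tsum_prod.symm
  have term_le (k j : ℤ × ℤ) :
      |sym x j * sym y (k - j)| * wt ν k ≤ A j * B (k - j) := by
    calc _ ≤ |sym x j * sym y (k - j)| * (wt ν j * wt ν (k - j)) := by
          gcongr
          exact wt_le_mul_wt_sub hν j k
      _ = A j * B (k - j) := by simp only [A, B, abs_mul]; ring
  have hfactor (k : ℤ × ℤ) : Summable (fun j => A j * B (k - j)) := hC.prod_factor k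
  have habs (k : ℤ × ℤ) : Summable (fun j => |sym x j * sym y (k - j)|) :=
    Summable.of_nonneg_of_le (fun _ => abs_nonneg _)
      (fun j => (le_mul_of_one_le_right (abs_nonneg _) (one_le_wt hν k)).trans (term_le k j))
      (hfactor k)
  have conv_le (k : ℤ × ℤ) :
      |conv (sym x) (sym y) k| * wt ν k ≤ ∑' j, A j * B (k - j) := by
    calc _ ≤ (∑' j, |sym x j * sym y (k - j)|) * wt ν k := by
          refine mul_le_mul_of_nonneg_right ?_ (wt_nonneg k)
          have h := norm_tsum_le_tsum_norm (f := fun j => sym x j * sym y (k - j))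
            (by simpa only [Real.norm_eq_abs] using habs k)
          simpa only [Real.norm_eq_abs, conv] using h
      _ = ∑' j, |sym x j * sym y (k - j)| * wt ν k := tsum_mul_right.symm
      _ ≤ _ := ((habs k).mul_right (wt ν k)).tsum_le_tsum (term_le k) (hfactor k)
  have conv_nonneg (k : ℤ × ℤ) : 0 ≤ |conv (sym x) (sym y) k| * wt ν k :=
    mul_nonneg (abs_nonneg _) (wt_nonneg k)
  have hconv : Summable (fun k => |conv (sym x) (sym y) k| * wt ν k) :=
    Summable.of_nonneg_of_le conv_nonneg conv_le hC.prod
  refine ⟨fun k => (habs k).of_abs, hconv.comp_injective Subtype.val_injective, ?_⟩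
  calc _ ≤ ∑' k, |conv (sym x) (sym y) k| * wt ν k :=
        tsum_comp_le_tsum_of_inj hconv conv_nonneg Subtype.val_injective
    _ ≤ ∑' k, ∑' j, A j * B (k - j) := hconv.tsum_le_tsum conv_le hC.prod
    _ = (∑' k, A k) * ∑' k, B k := hC_tsum
    _ ≤ _ := mul_le_mul hXle hYle (tsum_nonneg hB) ((tsum_nonneg hA).trans hXle)
    _ = _ := by ring
end

section
/- Let λ > 0, L > 0 and define μ_k = L² k₁² / (4π² k₂²) + 4π² λ k₂² − 1 for k = (k₁,k₂) ∈ ℤ² with k₂ ≠ 0. Let m = (m₁,m₂) with m₁, m₂ ≥ 1 integers satisfying m₂ ≥ max{ m₁, L/(2π²√λ) }. Set F_m^± = {(k₁,k₂) ∈ ℤ² : |k₁| < m₁, 0 < |k₂| < m₂}, and for p = (p₁,p₂) ∈ F_m^±, q = (q₁,q₂) with q₁ ∈ [0, 3m₁), q₂ ∈ [3m₂, 4m₂), and q̂ = (q₁, q₂ − m₂), one has the identity μ_{p+q} − μ_{p+q̂} = m₂ (2(p₂+q₂) − m₂) [ 4π²λ − (L²/4π²) (p₁+q₁)² / ((p₂+q₂−m₂)²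 (p₂+q₂)²) ], and consequently μ_{p+q̂} ≤ μ_{p+q}. -/
open Real

/-- The symbol `μ_k = L² k₁²/(4π² k₂²) + 4π² λ k₂² − 1` of the linear part of the
Boussinesq equation (after dividing the k-th Fourier equation by `4π² k₂²`). -/
noncomputable def mu (lam L : ℝ) (k : ℤ × ℤ) : ℝ :=
  L ^ 2 * (k.1 : ℝ) ^ 2 / (4 * π ^ 2 * (k.2 : ℝ) ^ 2) + 4 * π ^ 2 * lam * (k.2 : ℝ) ^ 2 - 1

/-- The identity `μ_{p+q} − μ_{p+q̂} = m₂(2(p₂+q₂)−m₂)[4π²λ − (L²/4π²)(p₁+q₁)²/((p₂+q₂−m₂)²(p₂+q₂)²)]`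
for `q̂ = (q₁, q₂ − m₂)`, and the resulting monotonicity `μ_{p+q̂} ≤ μ_{p+q}`, under
the truncation condition `m₂ ≥ max{m₁, L/(2π²√λ)}`. -/
theorem mu_shift_identity (lam L : ℝ) (hlam : 0 < lam) (hL : 0 < L)
    (m₁ m₂ : ℤ) (hm₁ : 1 ≤ m₁) (hm₂ : 1 ≤ m₂) (hm₁₂ : m₁ ≤ m₂)
    (hcond : L / (2 * π ^ 2 * Real.sqrt lam) ≤ (m₂ : ℝ))
    (p q : ℤ × ℤ)
    (hp₁ : |p.1| < m₁) (hp₂ : 0 < |p.2|) (hp₂' : |p.2| < m₂)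
    (hq₁ : 0 ≤ q.1) (hq₁' : q.1 < 3 * m₁) (hq₂ : 3 * m₂ ≤ q.2) (hq₂' : q.2 < 4 * m₂) :
    mu lam L (p + q) - mu lam L (p + (q.1, q.2 - m₂)) =
      (m₂ : ℝ) * (2 * ((p.2 : ℝ) + (q.2 : ℝ)) - (m₂ : ℝ)) *
        (4 * π ^ 2 * lam - L ^ 2 / (4 * π ^ 2) *
          ((p.1 : ℝ) + (q.1 : ℝ)) ^ 2 /
            (((p.2 : ℝ) + (q.2 : ℝ) - (m₂ : ℝ)) ^ 2 * ((p.2 : ℝ) + (q.2 : ℝ)) ^ 2)) ∧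
    mu lam L (p + (q.1, q.2 - m₂)) ≤ mu lam L (p + q) := by
  obtain ⟨p₁, p₂⟩ := p
  obtain ⟨q₁, q₂⟩ := q
  simp only at hp₁ hp₂ hp₂' hq₁ hq₁' hq₂ hq₂'
  rw [abs_lt] at hp₁ hp₂'
  have hx_abs : |((p₁ : ℝ) + q₁)| ≤ 4 * m₂ := by
    have h : |p₁ + q₁| ≤ 4 * m₂ := abs_le.2 ⟨by omega, by omega⟩
    exact_mod_cast h
  have hy : 2 * (m₂ : ℝ) ≤ (p₂ : ℝ) + q₂ := by
    have h : 2 * m₂ ≤ p₂ + q₂ := by omega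
    exact_mod_cast h
  have hm : (0 : ℝ) < m₂ := by exact_mod_cast (by omega : 0 < m₂)
  have key : mu lam L ((p₁, p₂) + (q₁, q₂)) - mu lam L ((p₁, p₂) + (q₁, q₂ - m₂)) =
      (m₂ : ℝ) * (2 * ((p₂ : ℝ) + q₂) - m₂) *
        (4 * π ^ 2 * lam - L ^ 2 / (4 * π ^ 2) * ((p₁ : ℝ) + q₁) ^ 2 /
          (((p₂ : ℝ) + q₂ - m₂) ^ 2 * ((p₂ : ℝ) + q₂) ^ 2)) := by
    simp only [mu, Prod.mk_add_mk, Int.cast_add, Int.cast_sub, ← add_sub_assoc]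
    generalize (p₁ : ℝ) + q₁ = x at *
    generalize (p₂ : ℝ) + q₂ = y at *
    have hy₀ : y ≠ 0 := by linarith
    have hym₀ : y - m₂ ≠ 0 := by linarith
    field_simp
    ring
  refine ⟨key, sub_nonneg.1 ?_⟩
  rw [key]
  generalize (p₁ : ℝ) + q₁ = x at *
  generalize (p₂ : ℝ) + q₂ = y at *
  refine mul_nonneg (mul_nonneg hm.le (by linarith)) (sub_nonneg.2 ?_)
  have hx_sq : x ^ 2 ≤ (4 * (m₂ : ℝ)) ^ 2 := sq_le_sq.2 (hx_abs.trans (le_abs_self _))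
  have hL_sq : L ^ 2 ≤ 4 * π ^ 4 * lam * (m₂ : ℝ) ^ 2 := by
    rw [div_le_iff₀ (by positivity)] at hcond
    calc L ^ 2 ≤ ((m₂ : ℝ) * (2 * π ^ 2 * √lam)) ^ 2 := by gcongr
      _ = 4 * π ^ 4 * √lam ^ 2 * (m₂ : ℝ) ^ 2 := by ring
      _ = _ := by rw [sq_sqrt hlam.le]
  have hym : (m₂ : ℝ) ≤ y - m₂ := by linarith
  have hy_pos : 0 < y := by linarith
  have hym_pos : 0 < y - m₂ := by linarith
  rw [div_le_iff₀ (by positivity), div_mul_eq_mul_div, div_le_iff₀ (by positivity)]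
  calc L ^ 2 * x ^ 2 ≤ (4 * π ^ 4 * lam * (m₂ : ℝ) ^ 2) * (4 * (m₂ : ℝ)) ^ 2 := by gcongr
    _ = 16 * π ^ 4 * lam * ((m₂ : ℝ) ^ 2 * (2 * (m₂ : ℝ)) ^ 2) := by ring
    _ ≤ 16 * π ^ 4 * lam * ((y - m₂) ^ 2 * y ^ 2) := by gcongr
    _ = _ := by ring
end
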